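/- Fix λ_S > 0, λ_PT > 0, α > 0, β ∈ (0,1) and c > 0. For p > 0 set r_I(p) = c·p^{1/α} and r_p(p) = β·r_I(p), and define M(p) = λ_S·π·r_p(p)² · ∫₀^{r_p(p)} (2t/r_p(p)²) · exp( −λ_PT·( π·r_I(p)² − 2·r_I(p)²·arccos(t/(2r_I(p))) + t·√(r_I(p)² − t²/4) ) ) dt. Then M(p) = O(p^{−2/α}) as p → ∞, i.e. M is big-O of p ↦ p^{−2/α} along the filter at infinity. -/

import Mathlib

open Real MeasureTheory intervalIntegral Filter Asymptotics

theorem Real.self_le_arcsin {x : ℝ} (h0 : 0 ≤ x) (h1 : x ≤ 1) : x ≤ Real.arcsin x := by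
  have h := Real.sin_le (Real.arcsin_nonneg.2 h0)
  rwa [Real.sin_arcsin (by linarith) h1] at h

theorem integral_mul_exp_neg_mul_le {a R : ℝ} (ha : 0 < a) (hR : 0 ≤ R) :
    ∫ t in (0:ℝ)..R, t * Real.exp (-(a * t)) ≤ 1 / a ^ 2 := by
  have hderiv : ∀ t ∈ Set.uIcc 0 R, HasDerivAt
      (fun t : ℝ => -((t / a + 1 / a ^ 2) * Real.exp (-(a * t))))
      (t * Real.exp (-(a * t))) t := by
    intro t _
    have hlin : HasDerivAt (fun t : ℝ => t / a + 1 / a ^ 2) (1 / a) t :=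
      ((hasDerivAt_id t).div_const a).add_const _
    have hexp : HasDerivAt (fun t : ℝ => Real.exp (-(a * t)))
        (Real.exp (-(a * t)) * -(a * 1)) t :=
      (((hasDerivAt_id t).const_mul a).neg).exp
    refine (hlin.mul hexp).neg.congr_deriv ?_
    field_simp
    ring
  rw [integral_eq_sub_of_hasDerivAt hderiv
    (Continuous.intervalIntegrable (by fun_prop) _ _)]
  have hpos : 0 ≤ (R / a + 1 / a ^ 2) * Real.exp (-(a * R)) := by positivity
  simp only [zero_div, mul_zero, neg_zero, Real.exp_zero, zero_add, mul_one]
  linarith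

/-- The area of a disk of radius `r` left uncovered by a disk of the same radius whose center
is at distance `t` is at least `r * t`. -/
theorem mul_le_disk_diff_area {r t : ℝ} (hr : 0 < r) (ht0 : 0 ≤ t) (htr : t ≤ 2 * r) :
    r * t ≤ π * r ^ 2 - 2 * r ^ 2 * Real.arccos (t / (2 * r))
      + t * Real.sqrt (r ^ 2 - t ^ 2 / 4) := by
  have harcsin : t / (2 * r) ≤ Real.arcsin (t / (2 * r)) :=
    Real.self_le_arcsin (by positivity) ((div_le_one (by positivity)).2 htr)
  have hsqrt : 0 ≤ t * Real.sqrt (r ^ 2 - t ^ 2 / 4) := by positivity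
  have hmul := mul_le_mul_of_nonneg_left harcsin (by positivity : 0 ≤ 2 * r ^ 2)
  have heq : 2 * r ^ 2 * (t / (2 * r)) = r * t := by field_simp
  rw [Real.arccos]
  linarith

theorem integral_exp_disk_diff_area_le {lam r R : ℝ} (hlam : 0 < lam) (hr : 0 < r)
    (hR : 0 < R) (hRr : R ≤ 2 * r) :
    R ^ 2 * ∫ t in (0:ℝ)..R, (2 * t / R ^ 2) *
      Real.exp (-lam * (π * r ^ 2 - 2 * r ^ 2 * Real.arccos (t / (2 * r))
        + t * Real.sqrt (r ^ 2 - t ^ 2 / 4))) ≤ 2 / (lam * r) ^ 2 := by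
  have hmono : ∫ t in (0:ℝ)..R, (2 * t / R ^ 2) *
      Real.exp (-lam * (π * r ^ 2 - 2 * r ^ 2 * Real.arccos (t / (2 * r))
        + t * Real.sqrt (r ^ 2 - t ^ 2 / 4))) ≤
      ∫ t in (0:ℝ)..R, 2 / R ^ 2 * (t * Real.exp (-(lam * r * t))) := by
    refine integral_mono_on hR.le (Continuous.intervalIntegrable (by fun_prop) _ _)
      (Continuous.intervalIntegrable (by fun_prop) _ _) fun t ht => ?_
    have harea := mul_le_disk_diff_area hr ht.1 (ht.2.trans hRr)
    calc _ ≤ 2 * t / R ^ 2 * Real.exp (-(lam * r * t)) := by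
          have ht0 := ht.1
          gcongr
          linarith [mul_le_mul_of_nonneg_left harea hlam.le]
      _ = _ := by ring
  rw [intervalIntegral.integral_const_mul] at hmono
  have hint := integral_mul_exp_neg_mul_le (mul_pos hlam hr) hR.le
  calc _ ≤ R ^ 2 * (2 / R ^ 2 * ∫ t in (0:ℝ)..R, t * Real.exp (-(lam * r * t))) := by gcongr
    _ = 2 * ∫ t in (0:ℝ)..R, t * Real.exp (-(lam * r * t)) := by
          rw [← mul_assoc, mul_div_cancel₀ _ (pow_ne_zero 2 hR.ne')]
    _ ≤ 2 * (1 / (lam * r) ^ 2) := by gcongr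
    _ = _ := by ring

/-- Corollary 3: with `r_I(p) = c·p^{1/α}` and `r_p(p) = β·r_I(p)`, the conditional average
degree `M(p)` of a secondary user satisfies `M(p) = O(p^{−2/α})` as the transmission power
`p → ∞`. -/
theorem cond_avg_degree_bigO (lamS lamPT alpha beta c : ℝ)
    (hlamS : 0 < lamS) (hlamPT : 0 < lamPT) (halpha : 0 < alpha)
    (hbeta0 : 0 < beta) (hbeta1 : beta < 1) (hc : 0 < c)
    (r_I r_p M : ℝ → ℝ)
    (hrI : ∀ p, r_I p = c * p ^ (1 / alpha))
    (hrp : ∀ p, r_p p = beta * r_I p)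
    (hM : ∀ p, M p = lamS * π * (r_p p) ^ 2 *
        ∫ t in (0:ℝ)..(r_p p),
          (2 * t / (r_p p) ^ 2) *
            Real.exp (-lamPT * (π * (r_I p) ^ 2
              - 2 * (r_I p) ^ 2 * Real.arccos (t / (2 * r_I p))
              + t * Real.sqrt ((r_I p) ^ 2 - t ^ 2 / 4)))) :
    M =O[atTop] fun p : ℝ => p ^ (-2 / alpha) := by
  refine IsBigO.of_bound (lamS * π * (2 / (lamPT * c) ^ 2)) ?_
  filter_upwards [eventually_gt_atTop 0] with p hp
  have hr : 0 < r_I p := by rw [hrI]; positivity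
  have hR : 0 < r_p p := by rw [hrp]; positivity
  have hRr : r_p p ≤ 2 * r_I p := by rw [hrp]; nlinarith
  have hpow : (p ^ (1 / alpha)) ^ 2 * p ^ (-2 / alpha) = 1 := by
    rw [← Real.rpow_natCast, ← Real.rpow_mul hp.le, ← Real.rpow_add hp]
    convert Real.rpow_zero p using 2
    push_cast
    ring
  have hMnonneg : 0 ≤ M p := by
    rw [hM]
    refine mul_nonneg (by positivity) (integral_nonneg hR.le fun t ht => ?_)
    have ht0 := ht.1
    positivity
  rw [Real.norm_of_nonneg hMnonneg, Real.norm_of_nonneg (by positivity), hM,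
    mul_assoc (lamS * π), mul_assoc (lamS * π)]
  refine mul_le_mul_of_nonneg_left
    ((integral_exp_disk_diff_area_le hlamPT hr hR hRr).trans_eq ?_) (by positivity)
  have hq : 0 < p ^ (1 / alpha) := by positivity
  rw [hrI, eq_div_of_mul_eq (by positivity) ((mul_comm _ _).trans hpow)]
  field_simp
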